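/- arXiv:1210.8406 — 8 statements merged into one kernel-verified Lean document; each statement's English description precedes it below -/
import Mathlib

section
/- For every real γ with 0 < γ < N, a probability vector π ∈ ℝ^{N+1} satisfies π A(γ) = π if and only if π = e_0. In other words, the all-quiescent state v_off = e_0 is the unique stationary state of the mean-field transition matrix A(γ). -/
open Finset Topology Filter

/-- Mean-field firing probability of a downstream threshold-`θ` neuron given `n`
spiking neurons in the previous layer, with connectivity strength `γ`. -/
noncomputable def q (N θ : ℕ) (γ : ℝ) (n : ℕ) : ℝ :=
  ∑ k ∈ Finset.Icc θ n, (n.choose k : ℝ) * (γ / N) ^ k * (1 - γ / N) ^ (n - k)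

/-- Mean-field transition matrix `A(γ)` of the feedforward network. -/
noncomputable def A (N θ : ℕ) (γ : ℝ) : Matrix (Fin (N + 1)) (Fin (N + 1)) ℝ :=
  fun n m => (N.choose (m : ℕ) : ℝ) * (q N θ γ (n : ℕ)) ^ (m : ℕ) *
    (1 - q N θ γ (n : ℕ)) ^ (N - (m : ℕ))

lemma q_zero_aux (N θ : ℕ) (hθ1 : 1 ≤ θ) (γ : ℝ) : q N θ γ 0 = 0 := by
  unfold q
  rw [Finset.Icc_eq_empty (by omega), Finset.sum_empty]

lemma q_lt_one_aux (N θ : ℕ) (hN : 1 ≤ N) (hθ1 : 1 ≤ θ) (γ : ℝ) (hγ0 : 0 < γ) (hγN : γ < N)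
    (n : ℕ) : q N θ γ n < 1 := by
  have hNpos : (0 : ℝ) < N := by exact_mod_cast hN
  have hp0 : 0 < γ / N := by positivity
  have hp1 : 0 < 1 - γ / N := by
    have : γ / N < 1 := (div_lt_one hNpos).2 hγN
    linarith
  have h0 : (0 : ℕ) ∉ Finset.Icc θ n := by simp; omega
  have hsub : insert 0 (Finset.Icc θ n) ⊆ Finset.range (n + 1) := by
    intro k hk
    simp only [Finset.mem_insert, Finset.mem_Icc, Finset.mem_range] at hk ⊢
    omega
  have hle := Finset.sum_le_sum_of_subset_of_nonneg
    (f := fun k => (n.choose k : ℝ) * (γ / N) ^ k * (1 - γ / N) ^ (n - k)) hsub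
    (fun k _ _ => by positivity)
  have hone : ∑ k ∈ Finset.range (n + 1),
      (n.choose k : ℝ) * (γ / N) ^ k * (1 - γ / N) ^ (n - k) = 1 := by
    have h := add_pow (γ / N) (1 - γ / N) n
    rw [add_sub_cancel, one_pow] at h
    refine Eq.trans ?_ h.symm
    exact Finset.sum_congr rfl (fun k _ => by ring)
  rw [Finset.sum_insert h0, hone] at hle
  have : 0 < (1 - γ / N) ^ n := by positivity
  simp only [Nat.choose_zero_right, Nat.cast_one, pow_zero, Nat.sub_zero, one_mul] at hle
  unfold q
  linarith

/-- The all-quiescent state `v_off = e₀` is the unique stationary distribution of `A(γ)`. -/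
theorem stationary_iff_voff (N θ : ℕ) (hN : 1 ≤ N) (hθ1 : 1 ≤ θ) (hθN : θ ≤ N)
    (γ : ℝ) (hγ0 : 0 < γ) (hγN : γ < N)
    (π : Fin (N + 1) → ℝ) (hnonneg : ∀ n, 0 ≤ π n) (hsum : ∑ n, π n = 1) :
    (∀ m, ∑ n, π n * A N θ γ n m = π m) ↔
      π = fun j => if j = 0 then (1 : ℝ) else 0 := by
  have hpos : ∀ n, 0 < A N θ γ n 0 := by
    intro n
    have := q_lt_one_aux N θ hN hθ1 γ hγ0 hγN n
    have h : 0 < 1 - q N θ γ n := by linarith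
    simp only [A, Fin.val_zero, Nat.choose_zero_right, Nat.cast_one, pow_zero, Nat.sub_zero,
      one_mul]
    positivity
  have hA0 : ∀ m, A N θ γ 0 m = if m = 0 then 1 else 0 := by
    intro m
    simp only [A, Fin.val_zero, q_zero_aux N θ hθ1 γ, sub_zero, one_pow, mul_one]
    split_ifs with h
    · simp [h]
    · have : (m : ℕ) ≠ 0 := fun h' => h (Fin.ext h')
      simp [this]
  constructor
  · intro h
    have h0 := h 0
    rw [Fin.sum_univ_succ, hA0 0, if_pos rfl, mul_one] at h0
    have hz : ∑ i : Fin N, π i.succ * A N θ γ i.succ 0 = 0 := by linarith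
    rw [Finset.sum_eq_zero_iff_of_nonneg
      (fun i _ => mul_nonneg (hnonneg _) (hpos _).le)] at hz
    have hs : ∀ i : Fin N, π i.succ = 0 := fun i =>
      (mul_eq_zero.1 (hz i (Finset.mem_univ i))).resolve_right (hpos _).ne'
    rw [Fin.sum_univ_succ] at hsum
    simp only [hs, Finset.sum_const_zero, add_zero] at hsum
    funext j
    refine Fin.cases ?_ (fun i => ?_) j
    · simpa using hsum
    · simp [hs i, Fin.succ_ne_zero]
  · intro h m
    subst h
    simp [hA0]
end

section
/- Let λ : (0,N) → ℂ and v : (0,N) → ℂ^{N+1} be such that for every γ ∈ (0,N), v(γ) is a left eigenvector of A(γ) with eigenvalue λ(γ), i.e., v(γ) A(γ) = λ(γ) v(γ). Suppose the limits λ̃ = lim_{γ→N⁻} λ(γ) and ṽ = lim_{γ→N⁻} v(γ) exist. If λ̃ ≠ 0, then ṽ_m = 0 for every m with 0 < m < N; that is, ṽ lies in the span of e_0 (= v_off) and e_N (= v_on). -/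
open Finset Topology Filter

/-- If a family of left eigenpairs `(λ(γ), v(γ))` of `A(γ)` has limits `λ̃`, `ṽ` as
`γ → N⁻` and `λ̃ ≠ 0`, then the limiting eigenvector `ṽ` vanishes at every coordinate
`0 < m < N`, i.e. it lies in the span of `v_off = e₀` and `v_on = e_N`. -/
theorem limit_eigenvector_bimodal (N θ : ℕ) (hN : 1 ≤ N) (hθ1 : 1 ≤ θ) (hθN : θ ≤ N)
    (lam : ℝ → ℂ) (v : ℝ → Fin (N + 1) → ℂ)
    (heig : ∀ γ ∈ Set.Ioo (0 : ℝ) N, ∀ m,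
      ∑ n, v γ n * (A N θ γ n m : ℂ) = lam γ * v γ m)
    (lamT : ℂ) (vT : Fin (N + 1) → ℂ)
    (hlam : Tendsto lam (𝓝[Set.Ioo (0 : ℝ) N] N) (𝓝 lamT))
    (hv : ∀ m, Tendsto (fun γ => v γ m) (𝓝[Set.Ioo (0 : ℝ) N] N) (𝓝 (vT m)))
    (hlamT : lamT ≠ 0) :
    (∀ m : Fin (N + 1), 0 < (m : ℕ) → (m : ℕ) < N → vT m = 0) ∧
      ∃ a b : ℂ, vT = fun j =>
        a * (if j = 0 then 1 else 0) + b * (if j = Fin.last N then 1 else 0) := by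
  have hcont : ∀ n m : Fin (N + 1), Continuous (fun γ : ℝ => ((A N θ γ n m : ℝ) : ℂ)) := by
    intro n m
    unfold A q
    fun_prop
  have hNR : (N : ℝ) ≠ 0 := by positivity
  have hq : ∀ n : ℕ, q N θ (N : ℝ) n = 0 ∨ q N θ (N : ℝ) n = 1 := by
    intro n
    unfold q
    rw [div_self hNR, sub_self]
    by_cases h : θ ≤ n
    · right
      rw [Finset.sum_eq_single n]
      · simp
      · intro k hk hkn
        have := (Finset.mem_Icc.mp hk).2
        rw [zero_pow (by omega), mul_zero]
      · intro hn
        exact absurd (Finset.mem_Icc.mpr ⟨h, le_refl n⟩) hn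
    · left
      rw [Finset.Icc_eq_empty h, Finset.sum_empty]
  have hA : ∀ n m : Fin (N + 1), 0 < (m : ℕ) → (m : ℕ) < N → A N θ (N : ℝ) n m = 0 := by
    intro n m h0 h1
    unfold A
    rcases hq n with h | h
    · rw [h, zero_pow (by omega)]
      simp
    · rw [h, sub_self, zero_pow (n := N - (m : ℕ)) (by omega), mul_zero]
  have hNpos : (0 : ℝ) < N := by positivity
  haveI : (𝓝[Set.Ioo (0 : ℝ) N] (N : ℝ)).NeBot := right_nhdsWithin_Ioo_neBot hNpos
  have key : ∀ m : Fin (N + 1), 0 < (m : ℕ) → (m : ℕ) < N → vT m = 0 := by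
    intro m h0 h1
    have h2 : Tendsto (fun γ => ∑ n, v γ n * (A N θ γ n m : ℂ)) (𝓝[Set.Ioo (0 : ℝ) N] (N : ℝ))
        (𝓝 (∑ n, vT n * (A N θ (N : ℝ) n m : ℂ))) :=
      tendsto_finsetSum _ fun n _ =>
        (hv n).mul (((hcont n m).tendsto (N : ℝ)).mono_left nhdsWithin_le_nhds)
    have h3 := hlam.mul (hv m)
    have h4 : Tendsto (fun γ => ∑ n, v γ n * (A N θ γ n m : ℂ)) (𝓝[Set.Ioo (0 : ℝ) N] (N : ℝ))
        (𝓝 (lamT * vT m)) := by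
      refine h3.congr' ?_
      filter_upwards [self_mem_nhdsWithin] with γ hγ
      exact (heig γ hγ m).symm
    have h5 := tendsto_nhds_unique h4 h2
    rw [Finset.sum_eq_zero (fun n _ => by rw [hA n m h0 h1]; simp)] at h5
    exact (mul_eq_zero.mp h5).resolve_left hlamT
  refine ⟨key, vT 0, vT (Fin.last N), ?_⟩
  funext j
  by_cases hj0 : j = 0
  · subst hj0
    have : (0 : Fin (N + 1)) ≠ Fin.last N := by
      intro h
      have := congrArg Fin.val h
      simp at this
      omega
    simp [this]
  · by_cases hjN : j = Fin.last N
    · subst hjN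
      simp [hj0]
    · have h0 : 0 < (j : ℕ) := by
        rcases Nat.eq_zero_or_pos (j : ℕ) with h | h
        · exact absurd (Fin.ext h) hj0
        · exact h
      have h1 : (j : ℕ) < N := by
        rcases Nat.lt_or_ge (j : ℕ) N with h | h
        · exact h
        · exact absurd (Fin.ext (by simp; omega)) hjN
      simp [hj0, hjN, key j h0 h1]
end

section
/- Let λ : (0,N) → ℂ and v : (0,N) → ℂ^{N+1} be such that for every γ ∈ (0,N), v(γ) A(γ) = λ(γ) v(γ), and suppose the limits λ̃ = lim_{γ→N⁻} λ(γ) and ṽ = lim_{γ→N⁻} v(γ) exist. Then: (i) λ̃ · ṽ_m = 0 for every m with 0 < m < N; (ii) Σ_{n=0}^{θ−1} ṽ_n = λ̃ · ṽ_0; and (iii) Σ_{n=θ}^{N} ṽ_n = λ̃ · ṽ_N. -/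
open Finset Topology Filter

/-- Limiting relations satisfied by any convergent family of left eigenpairs of `A(γ)`
as `γ → N⁻`: (i) `λ̃ ṽ_m = 0` for `0 < m < N`, (ii) `∑_{n<θ} ṽ_n = λ̃ ṽ_0`,
(iii) `∑_{n≥θ} ṽ_n = λ̃ ṽ_N`. -/
theorem limit_eigen_relations (N θ : ℕ) (hN : 1 ≤ N) (hθ1 : 1 ≤ θ) (hθN : θ ≤ N)
    (lam : ℝ → ℂ) (v : ℝ → Fin (N + 1) → ℂ)
    (heig : ∀ γ ∈ Set.Ioo (0 : ℝ) N, ∀ m,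
      ∑ n, v γ n * (A N θ γ n m : ℂ) = lam γ * v γ m)
    (lamT : ℂ) (vT : Fin (N + 1) → ℂ)
    (hlam : Tendsto lam (𝓝[Set.Ioo (0 : ℝ) N] N) (𝓝 lamT))
    (hv : ∀ m, Tendsto (fun γ => v γ m) (𝓝[Set.Ioo (0 : ℝ) N] N) (𝓝 (vT m))) :
    (∀ m : Fin (N + 1), 0 < (m : ℕ) → (m : ℕ) < N → lamT * vT m = 0) ∧
      (∑ n ∈ Finset.univ.filter (fun n : Fin (N + 1) => (n : ℕ) < θ), vT n
        = lamT * vT 0) ∧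
      (∑ n ∈ Finset.univ.filter (fun n : Fin (N + 1) => θ ≤ (n : ℕ)), vT n
        = lamT * vT (Fin.last N)) := by
  have hN0 : (N : ℝ) ≠ 0 := by positivity
  have hq : ∀ n : ℕ, q N θ N n = if θ ≤ n then 1 else 0 := by
    intro n
    unfold q
    rw [div_self hN0, sub_self]
    split_ifs with h
    · rw [Finset.sum_eq_single n]
      · simp
      · intro k hk hkn
        have : n - k ≠ 0 := by
          have := (Finset.mem_Icc.mp hk).2
          omega
        simp [this]
      · intro hn
        exact absurd (Finset.mem_Icc.mpr ⟨h, le_refl n⟩) hn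
    · rw [Finset.Icc_eq_empty h, Finset.sum_empty]
  have hcont : ∀ n m, Continuous (fun γ => ((A N θ γ n m : ℝ) : ℂ)) := by
    intro n m
    unfold A q
    fun_prop
  have hne : (𝓝[Set.Ioo (0 : ℝ) N] (N : ℝ)).NeBot := by
    rw [nhdsWithin_Ioo_eq_nhdsLT (by positivity)]
    infer_instance
  have key : ∀ m, ∑ n, vT n * ((A N θ N n m : ℝ) : ℂ) = lamT * vT m := by
    intro m
    have h1 : Tendsto (fun γ => ∑ n, v γ n * ((A N θ γ n m : ℝ) : ℂ))
        (𝓝[Set.Ioo (0 : ℝ) N] N) (𝓝 (∑ n, vT n * ((A N θ N n m : ℝ) : ℂ))) :=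
      tendsto_finsetSum _ fun n _ =>
        (hv n).mul (((hcont n m).tendsto (N : ℝ)).mono_left nhdsWithin_le_nhds)
    have h2 := hlam.mul (hv m)
    refine tendsto_nhds_unique (h1.congr' ?_) h2
    filter_upwards [self_mem_nhdsWithin] with γ hγ
    exact heig γ hγ m
  refine ⟨?_, ?_, ?_⟩
  · intro m h0 hm
    rw [← key m]
    apply Finset.sum_eq_zero
    intro n _
    have h1 : (m : ℕ) ≠ 0 := by omega
    have h2 : N - (m : ℕ) ≠ 0 := by omega
    unfold A
    rw [hq]
    split_ifs <;> simp [h1, h2]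
  · rw [← key 0, Finset.sum_filter]
    apply Finset.sum_congr rfl
    intro n _
    have h2 : N ≠ 0 := by omega
    unfold A
    rw [hq]
    by_cases h : θ ≤ (n : ℕ)
    · simp [h, h2]
    · simp [h, not_le.mp h]
  · rw [← key (Fin.last N), Finset.sum_filter]
    apply Finset.sum_congr rfl
    intro n _
    have h2 : N ≠ 0 := by omega
    unfold A
    rw [hq]
    by_cases h : θ ≤ (n : ℕ)
    · simp [h]
    · simp [h, h2]
end

section
/- Let λ : (0,N) → ℂ and v : (0,N) → ℂ^{N+1} be such that for every γ ∈ (0,N), v(γ) A(γ) = λ(γ) v(γ), and suppose the limits λ̃ = lim_{γ→N⁻} λ(γ) and ṽ = lim_{γ→N⁻} v(γ) exist with ṽ ≠ 0. Then λ̃ = 0 or λ̃ = 1; that is, every convergent family of eigenvalues of the mean-field transition matrix whose eigenvectors converge to a nonzero limit has limiting eigenvalue either 0 or 1 as γ → N. -/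
open Finset Topology Filter

lemma q_at (N θ : ℕ) (hN : 1 ≤ N) (n : ℕ) : q N θ N n = if θ ≤ n then 1 else 0 := by
  have h0 : (N : ℝ) ≠ 0 := by positivity
  unfold q
  rw [div_self h0]
  split_ifs with h
  · rw [Finset.sum_eq_single n]
    · simp
    · intro k hk hkn
      have := Finset.mem_Icc.1 hk
      have h2 : n - k ≠ 0 := by omega
      simp [h2]
    · intro hn
      exact absurd (Finset.mem_Icc.2 ⟨h, le_rfl⟩) hn
  · rw [Finset.Icc_eq_empty h]
    simp

lemma A_at (N θ : ℕ) (hN : 1 ≤ N) (n m : Fin (N + 1)) :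
    A N θ N n m = if (m : ℕ) = (if θ ≤ (n : ℕ) then N else 0) then 1 else 0 := by
  unfold A
  rw [q_at N θ hN]
  have hm := m.2
  by_cases h : θ ≤ (n : ℕ)
  · by_cases h2 : (m : ℕ) = N
    · simp [h, h2]
    · have : N - (m : ℕ) ≠ 0 := by omega
      simp [h, h2, this]
  · by_cases h2 : (m : ℕ) = 0
    · simp [h, h2]
    · simp [h, h2]

lemma A_cont (N θ : ℕ) (n m : Fin (N + 1)) : Continuous (fun γ : ℝ => (A N θ γ n m : ℂ)) := by
  unfold A q
  fun_prop

/-- Every convergent family of left eigenvalues of `A(γ)` whose eigenvectors converge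
to a nonzero limit has limiting eigenvalue `0` or `1` as `γ → N⁻`. -/
theorem limit_eigenvalue_zero_or_one (N θ : ℕ) (hN : 1 ≤ N) (hθ1 : 1 ≤ θ) (hθN : θ ≤ N)
    (lam : ℝ → ℂ) (v : ℝ → Fin (N + 1) → ℂ)
    (heig : ∀ γ ∈ Set.Ioo (0 : ℝ) N, ∀ m,
      ∑ n, v γ n * (A N θ γ n m : ℂ) = lam γ * v γ m)
    (lamT : ℂ) (vT : Fin (N + 1) → ℂ)
    (hlam : Tendsto lam (𝓝[Set.Ioo (0 : ℝ) N] N) (𝓝 lamT))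
    (hv : ∀ m, Tendsto (fun γ => v γ m) (𝓝[Set.Ioo (0 : ℝ) N] N) (𝓝 (vT m)))
    (hvT : vT ≠ 0) :
    lamT = 0 ∨ lamT = 1 := by
  have hN0 : (0 : ℝ) < N := by exact_mod_cast hN
  have : (𝓝[Set.Ioo (0 : ℝ) N] (N : ℝ)).NeBot := by
    rw [← mem_closure_iff_nhdsWithin_neBot, closure_Ioo hN0.ne]
    exact ⟨hN0.le, le_rfl⟩
  have key : ∀ m, ∑ n, vT n * (A N θ N n m : ℂ) = lamT * vT m := by
    intro m
    have h1 : Tendsto (fun γ => ∑ n, v γ n * (A N θ γ n m : ℂ)) (𝓝[Set.Ioo (0 : ℝ) N] N)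
        (𝓝 (∑ n, vT n * (A N θ N n m : ℂ))) :=
      tendsto_finsetSum _ fun n _ =>
        (hv n).mul (((A_cont N θ n m).tendsto (N : ℝ)).mono_left nhdsWithin_le_nhds)
    refine tendsto_nhds_unique_of_eventuallyEq h1 (hlam.mul (hv m)) ?_
    filter_upwards [self_mem_nhdsWithin] with γ hγ using heig γ hγ m
  by_cases hl : lamT = 0
  · exact Or.inl hl
  right
  have mid : ∀ m : Fin (N + 1), (m : ℕ) ≠ 0 → (m : ℕ) ≠ N → vT m = 0 := by
    intro m h0 h1
    have h := key m
    rw [Finset.sum_eq_zero] at h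
    · exact (mul_eq_zero.1 h.symm).resolve_left hl
    · intro n _
      rw [A_at N θ hN, if_neg (by split_ifs <;> assumption)]
      simp
  obtain ⟨k, hk⟩ := Function.ne_iff.1 hvT
  have hk : vT k ≠ 0 := hk
  have hk' : (k : ℕ) = 0 ∨ (k : ℕ) = N := by
    by_contra! hc
    exact hk (mid k hc.1 hc.2)
  have h := key k
  rw [Finset.sum_eq_single k] at h
  · rw [A_at N θ hN, if_pos (by split_ifs <;> omega)] at h
    have h3 : (lamT - 1) * vT k = 0 := by
      rw [sub_mul, ← h]
      simp
    exact sub_eq_zero.1 ((mul_eq_zero.1 h3).resolve_right hk)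
  · intro n _ hn
    have hn' : (n : ℕ) ≠ k := fun h => hn (Fin.ext h)
    by_cases hm : (n : ℕ) ≠ 0 ∧ (n : ℕ) ≠ N
    · rw [mid n hm.1 hm.2, zero_mul]
    · rw [A_at N θ hN, if_neg (by split_ifs <;> omega)]
      simp
  · simp
end

section
/- Suppose N_E − N_I > θ. For every real γ with 0 < γ < N, a probability vector π on the pairs (n_E, n_I) satisfies π A_in(γ) = π if and only if π is the point mass at (0,0). In other words, the excitatory-inhibitory mean-field transition matrix A_in(γ) has a unique stationary state, corresponding to no inhibitory and no excitatory neurons spiking. -/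
open Finset Topology Filter

/-- Mean-field firing probability of a downstream threshold-`θ` neuron given `nE`
spiking excitatory and `nI` spiking inhibitory neurons in the previous layer, in a
network of `NE` excitatory and `NI` inhibitory neurons per layer. -/
noncomputable def qEI (NE NI θ : ℕ) (γ : ℝ) (nE nI : ℕ) : ℝ :=
  ∑ kE ∈ Finset.Icc θ nE, ∑ kI ∈ Finset.Icc 0 (min nI (kE - θ)),
    (nE.choose kE : ℝ) * (γ / (NE + NI)) ^ kE * (1 - γ / (NE + NI)) ^ (nE - kE) *
      ((nI.choose kI : ℝ) * (γ / (NE + NI)) ^ kI * (1 - γ / (NE + NI)) ^ (nI - kI))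

/-- Excitatory-inhibitory mean-field transition matrix `A_in(γ)`, indexed by pairs
`(n_E, n_I)` of spike counts. -/
noncomputable def Ain (NE NI θ : ℕ) (γ : ℝ) :
    Matrix (Fin (NE + 1) × Fin (NI + 1)) (Fin (NE + 1) × Fin (NI + 1)) ℝ :=
  fun n m =>
    (NE.choose (m.1 : ℕ) : ℝ) * (qEI NE NI θ γ (n.1 : ℕ) (n.2 : ℕ)) ^ (m.1 : ℕ) *
        (1 - qEI NE NI θ γ (n.1 : ℕ) (n.2 : ℕ)) ^ (NE - (m.1 : ℕ)) *
      ((NI.choose (m.2 : ℕ) : ℝ) * (qEI NE NI θ γ (n.1 : ℕ) (n.2 : ℕ)) ^ (m.2 : ℕ) *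
        (1 - qEI NE NI θ γ (n.1 : ℕ) (n.2 : ℕ)) ^ (NI - (m.2 : ℕ)))

lemma binom_sum_one (p : ℝ) (n : ℕ) :
    ∑ k ∈ Finset.range (n + 1), (n.choose k : ℝ) * p ^ k * (1 - p) ^ (n - k) = 1 := by
  have h := add_pow p (1 - p) n
  rw [add_sub_cancel, one_pow] at h
  refine Eq.trans ?_ h.symm
  exact Finset.sum_congr rfl fun k _ => by ring

lemma qEI_lt_one (NE NI θ : ℕ) (hθ : 1 ≤ θ) (γ : ℝ) (hγ0 : 0 < γ)
    (hγN : γ < (NE : ℝ) + (NI : ℝ)) (nE nI : ℕ) : qEI NE NI θ γ nE nI < 1 := by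
  unfold qEI
  have hN : (0 : ℝ) < (NE : ℝ) + NI := hγ0.trans hγN
  have hp0 : 0 < γ / ((NE : ℝ) + NI) := div_pos hγ0 hN
  have hp1 : γ / ((NE : ℝ) + NI) < 1 := (div_lt_one hN).2 hγN
  generalize γ / ((NE : ℝ) + NI) = p at hp0 hp1 ⊢
  have h1p : 0 < 1 - p := by linarith
  have hb : ∀ n k : ℕ, 0 ≤ (n.choose k : ℝ) * p ^ k * (1 - p) ^ (n - k) := by
    intro n k; positivity
  calc _ ≤ ∑ kE ∈ Finset.Icc θ nE, (nE.choose kE : ℝ) * p ^ kE * (1 - p) ^ (nE - kE) := by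
        apply Finset.sum_le_sum
        intro kE _
        rw [← Finset.mul_sum]
        apply mul_le_of_le_one_right (hb _ _)
        refine le_of_le_of_eq ?_ (binom_sum_one p nI)
        apply Finset.sum_le_sum_of_subset_of_nonneg
        · intro k hk
          simp only [Finset.mem_Icc, Finset.mem_range] at *
          omega
        · intro k _ _; exact hb _ _
    _ < ∑ kE ∈ Finset.range (nE + 1), (nE.choose kE : ℝ) * p ^ kE * (1 - p) ^ (nE - kE) := by
        refine Finset.sum_lt_sum_of_subset (i := 0) ?_ ?_ ?_ ?_ ?_
        · intro k hk
          simp only [Finset.mem_Icc, Finset.mem_range] at *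
          omega
        · simp
        · simp only [Finset.mem_Icc]; omega
        · simp only [Nat.choose_zero_right, Nat.cast_one, pow_zero]; positivity
        · intro k _ _; exact hb _ _
    _ = 1 := binom_sum_one p nE

lemma Ain_zero_row (NE NI θ : ℕ) (hθ : 1 ≤ θ) (γ : ℝ) (m : Fin (NE + 1) × Fin (NI + 1)) :
    Ain NE NI θ γ (0, 0) m =
      if m = ((0 : Fin (NE + 1)), (0 : Fin (NI + 1))) then (1 : ℝ) else 0 := by
  have hq : qEI NE NI θ γ 0 0 = 0 := by
    unfold qEI
    rw [Finset.Icc_eq_empty (by omega), Finset.sum_empty]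
  obtain ⟨a, b⟩ := m
  simp only [Ain, Fin.val_zero, hq, sub_zero, one_pow, mul_one, Prod.mk.injEq]
  by_cases ha : a = 0
  · by_cases hb : b = 0
    · simp [ha, hb]
    · have : (b : ℕ) ≠ 0 := fun h => hb (Fin.ext h)
      simp [hb, zero_pow this]
  · have : (a : ℕ) ≠ 0 := fun h => ha (Fin.ext h)
    simp [ha, zero_pow this]

/-- If `N_E − N_I > θ`, the point mass at `(0,0)` (no excitatory and no inhibitory
neurons spiking) is the unique stationary distribution of `A_in(γ)`. -/
theorem EI_stationary_iff_voff (NE NI θ : ℕ) (hNE : 1 ≤ NE) (hNI : 1 ≤ NI) (hθ : 1 ≤ θ)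
    (hgap : (θ : ℤ) < (NE : ℤ) - (NI : ℤ))
    (γ : ℝ) (hγ0 : 0 < γ) (hγN : γ < (NE : ℝ) + (NI : ℝ))
    (π : Fin (NE + 1) × Fin (NI + 1) → ℝ)
    (hnonneg : ∀ n, 0 ≤ π n) (hsum : ∑ n, π n = 1) :
    (∀ m, ∑ n, π n * Ain NE NI θ γ n m = π m) ↔
      π = fun j => if j = ((0 : Fin (NE + 1)), (0 : Fin (NI + 1))) then (1 : ℝ) else 0 := by
  constructor
  · intro h
    have h0 := h (0, 0)
    have hpos : ∀ n, 0 < Ain NE NI θ γ n (0, 0) := by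
      intro n
      have := qEI_lt_one NE NI θ hθ γ hγ0 hγN n.1 n.2
      have h1 : 0 < 1 - qEI NE NI θ γ n.1 n.2 := by linarith
      simp only [Ain, Fin.val_zero, Nat.choose_zero_right, Nat.cast_one, pow_zero]
      positivity
    rw [← Finset.add_sum_erase _ _ (Finset.mem_univ ((0 : Fin (NE + 1)), (0 : Fin (NI + 1)))),
      Ain_zero_row NE NI θ hθ, if_pos rfl, mul_one, add_eq_left,
      Finset.sum_eq_zero_iff_of_nonneg
        (fun n _ => mul_nonneg (hnonneg n) (hpos n).le)] at h0
    have hz : ∀ n, n ≠ ((0 : Fin (NE + 1)), (0 : Fin (NI + 1))) → π n = 0 := by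
      intro n hn
      have := h0 n (Finset.mem_erase.2 ⟨hn, Finset.mem_univ _⟩)
      exact (mul_eq_zero.1 this).resolve_right (hpos n).ne'
    rw [Finset.sum_eq_single_of_mem ((0 : Fin (NE + 1)), (0 : Fin (NI + 1)))
      (Finset.mem_univ _) (fun n _ hn => hz n hn)] at hsum
    funext j
    by_cases hj : j = ((0 : Fin (NE + 1)), (0 : Fin (NI + 1)))
    · rw [if_pos hj, hj, hsum]
    · rw [if_neg hj, hz j hj]
  · rintro rfl m
    simp only [ite_mul, one_mul, zero_mul, Finset.sum_ite_eq', Finset.mem_univ, if_true]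
    exact Ain_zero_row NE NI θ hθ γ m
end

section
/- Suppose N_E − N_I > θ. Let λ : (0,N) → ℂ and v : (0,N) → ℂ^{(N_E+1)(N_I+1)} (indexed by pairs (m_E,m_I)) be such that for every γ ∈ (0,N), v(γ) A_in(γ) = λ(γ) v(γ), and suppose the limits λ̃ = lim_{γ→N⁻} λ(γ) and ṽ = lim_{γ→N⁻} v(γ) exist. If λ̃ ≠ 0, then ṽ_{(m_E,m_I)} = 0 for every pair (m_E,m_I) other than (0,0) and (N_E,N_I); that is, ṽ lies in the span of the vector corresponding to all neurons quiescent and the vector corresponding to all excitatory and inhibitory neurons firing. -/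
open Finset Topology Filter

theorem qEI_one (NE NI θ : ℕ) (hNE : 1 ≤ NE) (nE nI : ℕ) :
    qEI NE NI θ ((NE : ℝ) + NI) nE nI = 0 ∨ qEI NE NI θ ((NE : ℝ) + NI) nE nI = 1 := by
  have hN : (NE : ℝ) + NI ≠ 0 := by positivity
  have h : qEI NE NI θ ((NE : ℝ) + NI) nE nI =
      ∑ kE ∈ Finset.Icc θ nE, if kE = nE then
        (∑ kI ∈ Finset.Icc 0 (min nI (kE - θ)), if kI = nI then (1 : ℝ) else 0) else 0 := by
    unfold qEI
    refine Finset.sum_congr rfl fun kE hkE => ?_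
    rw [Finset.mem_Icc] at hkE
    split_ifs with h1
    · refine Finset.sum_congr rfl fun kI hkI => ?_
      rw [Finset.mem_Icc] at hkI
      split_ifs with h2
      · subst h1 h2
        simp [div_self hN]
      · have : nI - kI ≠ 0 := by omega
        simp [div_self hN, this]
    · refine Finset.sum_eq_zero fun kI hkI => ?_
      have : nE - kE ≠ 0 := by omega
      simp [div_self hN, this]
  rw [h, Finset.sum_ite_eq']
  split_ifs with h1
  · rw [Finset.sum_ite_eq']
    split_ifs
    · exact Or.inr rfl
    · exact Or.inl rfl
  · exact Or.inl rfl

theorem Ain_one (NE NI θ : ℕ) (hNE : 1 ≤ NE) (n m : Fin (NE + 1) × Fin (NI + 1))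
    (h0 : m ≠ ((0 : Fin (NE + 1)), (0 : Fin (NI + 1))))
    (h1 : m ≠ (Fin.last NE, Fin.last NI)) :
    Ain NE NI θ ((NE : ℝ) + NI) n m = 0 := by
  obtain ⟨a, b⟩ := m
  simp only [ne_eq, Prod.mk.injEq, Fin.ext_iff, Fin.val_zero, Fin.val_last] at h0 h1
  have ha := a.2
  have hb := b.2
  unfold Ain
  rcases qEI_one NE NI θ hNE n.1 n.2 with h | h
  · rw [h]
    by_cases hz : (a : ℕ) = 0
    · have : (b : ℕ) ≠ 0 := by tauto
      simp only [zero_pow this]; simp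
    · simp only [zero_pow hz]; simp
  · rw [h, sub_self]
    by_cases hz : NE - (a : ℕ) = 0
    · have : NI - (b : ℕ) ≠ 0 := by omega
      simp only [zero_pow this]; simp
    · simp only [zero_pow hz]; simp

theorem Ain_cont (NE NI θ : ℕ) (n m : Fin (NE + 1) × Fin (NI + 1)) :
    Continuous fun γ => (Ain NE NI θ γ n m : ℂ) := by
  refine Complex.continuous_ofReal.comp ?_
  unfold Ain qEI
  fun_prop

/-- If `N_E − N_I > θ` and a family of left eigenpairs `(λ(γ), v(γ))` of `A_in(γ)` has
limits `λ̃ ≠ 0` and `ṽ` as `γ → N⁻` (`N = N_E + N_I`), then `ṽ` vanishes at every index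
other than `(0,0)` (all quiescent) and `(N_E, N_I)` (all firing). -/
theorem EI_limit_eigenvector_bimodal (NE NI θ : ℕ)
    (hNE : 1 ≤ NE) (hNI : 1 ≤ NI) (hθ : 1 ≤ θ)
    (hgap : (θ : ℤ) < (NE : ℤ) - (NI : ℤ))
    (lam : ℝ → ℂ) (v : ℝ → Fin (NE + 1) × Fin (NI + 1) → ℂ)
    (heig : ∀ γ ∈ Set.Ioo (0 : ℝ) ((NE : ℝ) + NI), ∀ m,
      ∑ n, v γ n * (Ain NE NI θ γ n m : ℂ) = lam γ * v γ m)
    (lamT : ℂ) (vT : Fin (NE + 1) × Fin (NI + 1) → ℂ)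
    (hlam : Tendsto lam (𝓝[Set.Ioo (0 : ℝ) ((NE : ℝ) + NI)] ((NE : ℝ) + NI)) (𝓝 lamT))
    (hv : ∀ m, Tendsto (fun γ => v γ m)
      (𝓝[Set.Ioo (0 : ℝ) ((NE : ℝ) + NI)] ((NE : ℝ) + NI)) (𝓝 (vT m)))
    (hlamT : lamT ≠ 0) :
    ∀ m : Fin (NE + 1) × Fin (NI + 1),
      m ≠ ((0 : Fin (NE + 1)), (0 : Fin (NI + 1))) →
      m ≠ (Fin.last NE, Fin.last NI) → vT m = 0 := by
  intro m h0 h1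
  have hN : (0 : ℝ) < (NE : ℝ) + NI := by positivity
  haveI : (𝓝[Set.Ioo (0 : ℝ) ((NE : ℝ) + NI)] ((NE : ℝ) + NI)).NeBot :=
    right_nhdsWithin_Ioo_neBot hN
  have hL : Tendsto (fun γ => ∑ n, v γ n * (Ain NE NI θ γ n m : ℂ))
      (𝓝[Set.Ioo (0 : ℝ) ((NE : ℝ) + NI)] ((NE : ℝ) + NI))
      (𝓝 (∑ n, vT n * (Ain NE NI θ ((NE : ℝ) + NI) n m : ℂ))) :=
    tendsto_finsetSum _ fun n _ =>
      (hv n).mul ((Ain_cont NE NI θ n m).continuousAt.tendsto.mono_left nhdsWithin_le_nhds)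
  have hR := hlam.mul (hv m)
  have hE : (fun γ => ∑ n, v γ n * (Ain NE NI θ γ n m : ℂ))
      =ᶠ[𝓝[Set.Ioo (0 : ℝ) ((NE : ℝ) + NI)] ((NE : ℝ) + NI)] fun γ => lam γ * v γ m := by
    filter_upwards [self_mem_nhdsWithin] with γ hγ
    exact heig γ hγ m
  have key := tendsto_nhds_unique (hL.congr' hE) hR
  simp only [Ain_one NE NI θ hNE _ m h0 h1, Complex.ofReal_zero, mul_zero,
    Finset.sum_const_zero] at key
  exact (mul_eq_zero.mp key.symm).resolve_left hlamT
end

section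
/- The characteristic polynomial of the limit matrix Ã equals X^{N−1} · (X − 1)^2; in particular, Ã has eigenvalue 1 with algebraic multiplicity 2 and eigenvalue 0 with algebraic multiplicity N − 1. -/
open Finset Polynomial

/-- The limit matrix `Ã`: rows `n < θ` equal `e₀`, rows `n ≥ θ` equal `e_N`. -/
def Atilde (N θ : ℕ) : Matrix (Fin (N + 1)) (Fin (N + 1)) ℝ :=
  fun n m => if ((n : ℕ) < θ ∧ m = 0) ∨ (θ ≤ (n : ℕ) ∧ m = Fin.last N) then 1 else 0

/-- The characteristic polynomial of `Ã` is `X^{N−1}(X−1)²`; in particular `Ã` has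
eigenvalue `1` with algebraic multiplicity `2` and eigenvalue `0` with algebraic
multiplicity `N − 1`. -/
theorem Atilde_charpoly (N θ : ℕ) (hN : 1 ≤ N) (hθ1 : 1 ≤ θ) (hθN : θ ≤ N) :
    (Atilde N θ).charpoly = X ^ (N - 1) * (X - 1) ^ 2 ∧
    ((Atilde N θ).charpoly).rootMultiplicity 1 = 2 ∧
    ((Atilde N θ).charpoly).rootMultiplicity 0 = N - 1 := by
  have h : (Atilde N θ).charpoly = X ^ (N - 1) * (X - 1) ^ 2 := by
    let U : Matrix (Fin (N + 1)) (Fin 2) ℝ :=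
      fun n j => if j = 0 then (if (n : ℕ) < θ then 1 else 0) else (if (n : ℕ) < θ then 0 else 1)
    let V : Matrix (Fin 2) (Fin (N + 1)) ℝ :=
      fun j m => if j = 0 then (if m = 0 then 1 else 0) else (if m = Fin.last N then 1 else 0)
    have hUV : Atilde N θ = U * V := by
      ext n m
      rw [Matrix.mul_apply, Fin.sum_univ_two]
      by_cases hn : (n : ℕ) < θ
      · simp [Atilde, U, V, hn, not_le.mpr hn]
      · simp [Atilde, U, V, hn, not_lt.mp hn]
    have hVU : V * U = 1 := by
      have h1 : 0 < θ := hθ1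
      ext i j
      rw [Matrix.mul_apply]
      fin_cases i
      · rw [Finset.sum_eq_single (0 : Fin (N + 1)) (by intro b _ hb; simp [V, hb]) (by simp)]
        fin_cases j <;> simp [U, V, h1]
      · rw [Finset.sum_eq_single (Fin.last N) (by intro b _ hb; simp [V, hb]) (by simp)]
        fin_cases j <;> simp [U, V, hθN]
    rw [hUV, Matrix.charpoly_mul_comm_of_le U V (by simp; omega), hVU, Matrix.charpoly_one]
    simp
  have e1 : (X - 1 : ℝ[X]) = X - C 1 := by simp
  have e0 : (X : ℝ[X]) = X - C 0 := by simp
  have hX : (X : ℝ[X]) ^ (N - 1) ≠ 0 := pow_ne_zero _ X_ne_zero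
  have hX1 : (X - 1 : ℝ[X]) ^ 2 ≠ 0 := by
    rw [e1]; exact pow_ne_zero _ (X_sub_C_ne_zero 1)
  refine ⟨h, ?_, ?_⟩
  · rw [h, rootMultiplicity_mul (mul_ne_zero hX hX1),
      rootMultiplicity_eq_zero (by simp [IsRoot]), e1, rootMultiplicity_X_sub_C_pow]
  · rw [h, rootMultiplicity_mul (mul_ne_zero hX hX1),
      rootMultiplicity_eq_zero (p := (X - 1 : ℝ[X]) ^ 2) (by simp [IsRoot]), e0,
      rootMultiplicity_X_sub_C_pow, add_zero]
end

section
/- There exists exactly one probability vector π ∈ ℝ^{N+1} with π A_noisy(γ) = π, and this stationary state has all components strictly positive: π_m > 0 for every m ∈ {0,…,N}. In particular, the stationary state of the noisy mean-field chain is neither the all-quiescent state e_0 nor the all-firing state e_N. -/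
open Finset MeasureTheory

/-- Density of a centered Gaussian with standard deviation `σ`. -/
noncomputable def gauss (σ x : ℝ) : ℝ :=
  (1 / (σ * Real.sqrt (2 * Real.pi))) * Real.exp (-(x ^ 2) / (2 * σ ^ 2))

/-- Noisy mean-field firing probability `q_n^σ(γ)` of a downstream threshold-`θ` neuron
receiving independent `N(0,σ²)` background noise, given `n` spiking neurons upstream. -/
noncomputable def qNoisy (N θ : ℕ) (γ σ : ℝ) (n : ℕ) : ℝ :=
  (∫ x in ((θ : ℝ) - n)..(θ : ℝ), gauss σ x *
      ∑ k ∈ Finset.Icc (⌈(θ : ℝ) - x⌉₊) n,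
        (n.choose k : ℝ) * (γ / N) ^ k * (1 - γ / N) ^ (n - k)) +
  ∫ x in Set.Ioi (θ : ℝ), gauss σ x

/-- Noisy mean-field transition matrix `A_noisy(γ)`. -/
noncomputable def Anoisy (N θ : ℕ) (γ σ : ℝ) : Matrix (Fin (N + 1)) (Fin (N + 1)) ℝ :=
  fun n m => (N.choose (m : ℕ) : ℝ) * (qNoisy N θ γ σ (n : ℕ)) ^ (m : ℕ) *
    (1 - qNoisy N θ γ σ (n : ℕ)) ^ (N - (m : ℕ))

lemma gauss_pos (σ x : ℝ) (hσ : 0 < σ) : 0 < gauss σ x := by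
  unfold gauss
  have := Real.pi_pos
  positivity

lemma gauss_eq (σ : ℝ) (hσ : 0 < σ) :
    gauss σ = ProbabilityTheory.gaussianPDFReal 0 (σ ^ 2).toNNReal := by
  funext x
  have h : √(2 * Real.pi * σ ^ 2) = σ * √(2 * Real.pi) := by
    rw [Real.sqrt_mul' _ (sq_nonneg σ), Real.sqrt_sq hσ.le, mul_comm]
  simp only [gauss, ProbabilityTheory.gaussianPDFReal, Real.coe_toNNReal _ (sq_nonneg σ), h,
    sub_zero, one_div]

lemma gauss_integrable (σ : ℝ) (hσ : 0 < σ) : Integrable (gauss σ) := by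
  rw [gauss_eq σ hσ]
  exact ProbabilityTheory.integrable_gaussianPDFReal _ _

lemma gauss_integral (σ : ℝ) (hσ : 0 < σ) : ∫ x, gauss σ x = 1 := by
  rw [gauss_eq σ hσ]
  apply ProbabilityTheory.integral_gaussianPDFReal_eq_one
  intro h
  have h2 := Real.toNNReal_eq_zero.1 h
  have : 0 < σ ^ 2 := by positivity
  linarith

lemma gauss_set_pos (σ : ℝ) (hσ : 0 < σ) (s : Set ℝ) (hs : 0 < volume s) :
    0 < ∫ x in s, gauss σ x := by
  rw [integral_pos_iff_support_of_nonneg (fun x => (gauss_pos σ x hσ).le)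
    (gauss_integrable σ hσ).integrableOn]
  have : Function.support (gauss σ) = Set.univ := by
    ext x; simp [(gauss_pos σ x hσ).ne']
  rw [this]
  simpa using hs

lemma binsum_bounds (p : ℝ) (h0 : 0 ≤ p) (h1 : p ≤ 1) (n a : ℕ) :
    0 ≤ ∑ k ∈ Finset.Icc a n, (n.choose k : ℝ) * p ^ k * (1 - p) ^ (n - k) ∧
    ∑ k ∈ Finset.Icc a n, (n.choose k : ℝ) * p ^ k * (1 - p) ^ (n - k) ≤ 1 := by
  have h2 : 0 ≤ 1 - p := by linarith
  refine ⟨Finset.sum_nonneg fun k _ => by positivity, ?_⟩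
  calc _ ≤ ∑ k ∈ Finset.range (n + 1), (n.choose k : ℝ) * p ^ k * (1 - p) ^ (n - k) := by
        apply Finset.sum_le_sum_of_subset_of_nonneg
        · intro k hk
          simp only [Finset.mem_Icc, Finset.mem_range] at *
          omega
        · intro k _ _; positivity
    _ = (p + (1 - p)) ^ n := by
        rw [add_pow]
        exact Finset.sum_congr rfl fun k _ => by ring
    _ = 1 := by simp

lemma q_bounds (N θ : ℕ) (hN : 1 ≤ N) (γ σ : ℝ) (hγ0 : 0 < γ) (hγN : γ < N) (hσ : 0 < σ)
    (n : ℕ) : 0 < qNoisy N θ γ σ n ∧ qNoisy N θ γ σ n < 1 := by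
  have hN' : (0 : ℝ) < N := by exact_mod_cast hN
  have hb := binsum_bounds (γ / N) (by positivity) ((div_le_one hN').2 hγN.le) n
  have hle : (θ : ℝ) - n ≤ θ := by
    have : (0 : ℝ) ≤ n := n.cast_nonneg
    linarith
  have hI := gauss_integrable σ hσ
  unfold qNoisy
  rw [intervalIntegral.integral_of_le hle]
  have hpos := gauss_set_pos σ hσ (Set.Ioi (θ : ℝ)) (by simp)
  have hpos2 := gauss_set_pos σ hσ (Set.Iic ((θ : ℝ) - n)) (by simp)
  constructor
  · refine add_pos_of_nonneg_of_pos (integral_nonneg fun x => ?_) hpos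
    exact mul_nonneg (gauss_pos σ x hσ).le (hb _).1
  · have h1 : (∫ x in Set.Ioc ((θ : ℝ) - n) θ, gauss σ x *
      ∑ k ∈ Finset.Icc (⌈(θ : ℝ) - x⌉₊) n,
        (n.choose k : ℝ) * (γ / N) ^ k * (1 - γ / N) ^ (n - k)) ≤
        ∫ x in Set.Ioc ((θ : ℝ) - n) θ, gauss σ x := by
      apply integral_mono_of_nonneg
      · exact Filter.Eventually.of_forall fun x =>
          mul_nonneg (gauss_pos σ x hσ).le (hb _).1
      · exact hI.integrableOn
      · exact Filter.Eventually.of_forall fun x =>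
          mul_le_of_le_one_right (gauss_pos σ x hσ).le (hb _).2
    have h2 : (∫ x in Set.Ioc ((θ : ℝ) - n) θ, gauss σ x) + ∫ x in Set.Ioi (θ : ℝ), gauss σ x
        = ∫ x in Set.Ioi ((θ : ℝ) - n), gauss σ x := by
      rw [← setIntegral_union (Set.Ioc_disjoint_Ioi le_rfl) measurableSet_Ioi hI.integrableOn
        hI.integrableOn, Set.Ioc_union_Ioi_eq_Ioi hle]
    have h3 : (∫ x in Set.Iic ((θ : ℝ) - n), gauss σ x) + ∫ x in Set.Ioi ((θ : ℝ) - n), gauss σ x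
        = 1 := by
      rw [← gauss_integral σ hσ]
      exact intervalIntegral.integral_Iic_add_Ioi hI.integrableOn hI.integrableOn
    linarith

section PF
variable {ι : Type} [Fintype ι]

lemma pf_abs (A : Matrix ι ι ℝ) (hA : ∀ i j, 0 < A i j) (hs : ∀ i, ∑ j, A i j = 1)
    (d : ι → ℝ) (hd : ∀ m, ∑ n, d n * A n m = d m) (m : ι) : ∑ n, |d n| * A n m = |d m| := by
  have h1 : ∀ m ∈ Finset.univ, |d m| ≤ ∑ n, |d n| * A n m := by
    intro m _
    rw [← hd m]
    refine (Finset.abs_sum_le_sum_abs _ _).trans (le_of_eq ?_)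
    exact Finset.sum_congr rfl fun n _ => by rw [abs_mul, abs_of_pos (hA n m)]
  have h2 : ∑ m, |d m| = ∑ m, ∑ n, |d n| * A n m := by
    rw [Finset.sum_comm]
    exact Finset.sum_congr rfl fun n _ => by rw [← Finset.mul_sum, hs, mul_one]
  exact ((Finset.sum_eq_sum_iff_of_le h1).1 h2 m (Finset.mem_univ m)).symm

lemma pf_pos (A : Matrix ι ι ℝ) (hA : ∀ i j, 0 < A i j)
    (w : ι → ℝ) (h0 : ∀ n, 0 ≤ w n) (hw : ∀ m, ∑ n, w n * A n m = w m) (k : ι) (hk : w k ≠ 0)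
    (m : ι) : 0 < w m := by
  rw [← hw m]
  exact Finset.sum_pos' (fun n _ => mul_nonneg (h0 n) (hA n m).le)
    ⟨k, Finset.mem_univ k, mul_pos ((h0 k).lt_of_ne' hk) (hA k m)⟩

lemma pf_zero [Nonempty ι] (A : Matrix ι ι ℝ) (hA : ∀ i j, 0 < A i j)
    (hs : ∀ i, ∑ j, A i j = 1)
    (d : ι → ℝ) (hd : ∀ m, ∑ n, d n * A n m = d m) (h0 : ∑ n, d n = 0) (k : ι) : d k = 0 := by
  have habs := pf_abs A hA hs d hd
  by_cases h : ∃ k, |d k| + d k ≠ 0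
  · obtain ⟨k, hk⟩ := h
    have hp := pf_pos A hA (fun n => |d n| + d n) (fun n => by linarith [neg_abs_le (d n)])
      (fun m => by simp only [add_mul, Finset.sum_add_distrib, habs, hd]) k hk
    have : 0 < ∑ n, d n := Finset.sum_pos (fun n _ => by
      by_contra hc
      have := hp n
      simp only [abs_of_nonpos (not_lt.1 hc)] at this
      linarith) Finset.univ_nonempty
    linarith
  · push Not at h
    have h1 : ∀ n ∈ Finset.univ, d n ≤ 0 := fun n _ => by linarith [h n, abs_nonneg (d n)]
    exact (Finset.sum_eq_zero_iff_of_nonpos h1).1 h0 k (Finset.mem_univ k)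

lemma pf_exists [DecidableEq ι] [Nonempty ι] (A : Matrix ι ι ℝ) (hA : ∀ i j, 0 < A i j)
    (hs : ∀ i, ∑ j, A i j = 1) :
    ∃ w : ι → ℝ, (∀ m, 0 < w m) ∧ ∑ n, w n = 1 ∧ ∀ m, ∑ n, w n * A n m = w m := by
  have hdet : (A - 1).det = 0 := by
    rw [← Matrix.exists_mulVec_eq_zero_iff]
    refine ⟨fun _ => 1, fun h => ?_, ?_⟩
    · exact one_ne_zero (congrFun h (Classical.arbitrary ι))
    · rw [Matrix.sub_mulVec, Matrix.one_mulVec]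
      funext i
      simp [Matrix.mulVec, dotProduct, hs]
  obtain ⟨v, hv, hv0⟩ := Matrix.exists_vecMul_eq_zero_iff.2 hdet
  have hd : ∀ m, ∑ n, v n * A n m = v m := by
    intro m
    rw [Matrix.vecMul_sub, Matrix.vecMul_one] at hv0
    have := congrFun hv0 m
    simp only [Pi.sub_apply, Pi.zero_apply, Matrix.vecMul, dotProduct] at this
    linarith
  have habs := pf_abs A hA hs v hd
  obtain ⟨k, hk⟩ := Function.ne_iff.1 hv
  have hp := pf_pos A hA (fun n => |v n|) (fun n => abs_nonneg _) habs k (abs_ne_zero.2 hk)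
  have hS : 0 < ∑ n, |v n| := Finset.sum_pos (fun n _ => hp n) Finset.univ_nonempty
  refine ⟨fun n => |v n| / ∑ n, |v n|, fun m => div_pos (hp m) hS, ?_, fun m => ?_⟩
  · rw [← Finset.sum_div, div_self hS.ne']
  · simp only [div_mul_eq_mul_div]
    rw [← Finset.sum_div, habs]

end PF

/-- The noisy mean-field chain has exactly one stationary probability vector, and this
stationary state has all components strictly positive; in particular it is neither the
all-quiescent state `e₀` nor the all-firing state `e_N`. -/
theorem Anoisy_unique_positive_stationary (N θ : ℕ) (hN : 1 ≤ N) (hθ1 : 1 ≤ θ)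
    (hθN : θ ≤ N) (γ σ : ℝ) (hγ0 : 0 < γ) (hγN : γ < N) (hσ : 0 < σ) :
    ∃ π : Fin (N + 1) → ℝ,
      ((∀ n, 0 ≤ π n) ∧ (∑ n, π n = 1) ∧
        (∀ m, ∑ n, π n * Anoisy N θ γ σ n m = π m)) ∧
      (∀ m, 0 < π m) ∧
      π ≠ (fun j => if j = 0 then (1 : ℝ) else 0) ∧
      π ≠ (fun j => if j = Fin.last N then (1 : ℝ) else 0) ∧
      (∀ π' : Fin (N + 1) → ℝ, (∀ n, 0 ≤ π' n) → (∑ n, π' n = 1) →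
        (∀ m, ∑ n, π' n * Anoisy N θ γ σ n m = π' m) → π' = π) := by
  have hA : ∀ i j, 0 < Anoisy N θ γ σ i j := by
    intro i j
    obtain ⟨h0, h1⟩ := q_bounds N θ hN γ σ hγ0 hγN hσ i
    have h2 : 0 < 1 - qNoisy N θ γ σ i := by linarith
    have h3 : (0 : ℝ) < N.choose (j : ℕ) := by
      exact_mod_cast Nat.choose_pos (Nat.lt_succ_iff.1 j.2)
    unfold Anoisy
    positivity
  have hs : ∀ i, ∑ j, Anoisy N θ γ σ i j = 1 := by
    intro i
    unfold Anoisy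
    rw [Fin.sum_univ_eq_sum_range (fun m => (N.choose m : ℝ) * (qNoisy N θ γ σ i) ^ m *
      (1 - qNoisy N θ γ σ i) ^ (N - m))]
    have h := add_pow (qNoisy N θ γ σ i) (1 - qNoisy N θ γ σ i) N
    rw [add_sub_cancel, one_pow] at h
    refine Eq.trans ?_ h.symm
    exact Finset.sum_congr rfl fun k _ => by ring
  obtain ⟨w, hw, hw1, hwA⟩ := pf_exists _ hA hs
  have hne : Fin.last N ≠ 0 := by
    intro h
    have := congrArg Fin.val h
    simp at this
    omega
  refine ⟨w, ⟨fun n => (hw n).le, hw1, hwA⟩, hw, fun h => ?_, fun h => ?_, ?_⟩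
  · have := hw (Fin.last N)
    rw [h] at this
    simp [hne] at this
  · have := hw 0
    rw [h] at this
    simp [hne.symm] at this
  · intro w' _ h1 h2
    funext k
    have := pf_zero _ hA hs (fun n => w' n - w n)
      (fun m => by simp only [sub_mul, Finset.sum_sub_distrib, h2, hwA])
      (by rw [Finset.sum_sub_distrib, h1, hw1, sub_self]) k
    linarith
end
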